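/- For every n ≥ 1, the interior of the completely positive semidefinite cone is covered by the polyhedral cones C_r^n: int(CS+^n) ⊆ ⋃_{r ≥ 1} C_r^n ⊆ CS+^n, where the interior is taken within the space S^n of real symmetric n×n matrices. -/

import Mathlib

open Matrix

/-- The completely positive semidefinite cone `CS+^n`. -/
def IsCSPlus {n : ℕ} (A : Matrix (Fin n) (Fin n) ℝ) : Prop :=
  ∃ d : ℕ, 1 ≤ d ∧ ∃ X : Fin n → Matrix (Fin d) (Fin d) ℝ,
    (∀ i, (X i).PosSemidef) ∧ ∀ i j, A i j = (X i * X j).trace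

/-- A real number is rational with denominator at most `r`. -/
def RatDen (r : ℕ) (x : ℝ) : Prop :=
  ∃ (p : ℤ) (q : ℕ), 1 ≤ q ∧ q ≤ r ∧ x = (p : ℝ) / (q : ℝ)

/-- Membership in `Δ̲(n,r)`. -/
def InUDelta (n r : ℕ) (X : Fin n → Matrix (Fin r) (Fin r) ℝ) : Prop :=
  (∀ i, (X i).PosSemidef) ∧ (∑ i, (X i).trace) = 1 ∧ ∀ i k l, RatDen r (X i k l)

/-- The Gram matrix `(Tr(X_i X_j))_{i,j}` of a tuple of matrices. -/
def gramMat {n r : ℕ} (X : Fin n → Matrix (Fin r) (Fin r) ℝ) : Matrix (Fin n) (Fin n) ℝ :=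
  Matrix.of fun i j => (X i * X j).trace

/-- The cone `C_r^n`. -/
def InC (n r : ℕ) (A : Matrix (Fin n) (Fin n) ℝ) : Prop :=
  ∃ (m : ℕ) (c : Fin m → ℝ) (X : Fin m → Fin n → Matrix (Fin r) (Fin r) ℝ),
    (∀ k, 0 ≤ c k) ∧ (∀ k, InUDelta n r (X k)) ∧ A = ∑ k, c k • gramMat (X k)

/-! ### Direct sums of square matrices -/

/-- The block diagonal matrix with diagonal blocks `X` and `Y`, indexed by `Fin (d + e)`. -/
def finDirectSum {d e : ℕ} (X : Matrix (Fin d) (Fin d) ℝ) (Y : Matrix (Fin e) (Fin e) ℝ) :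
    Matrix (Fin (d + e)) (Fin (d + e)) ℝ :=
  (fromBlocks X 0 0 Y).submatrix finSumFinEquiv.symm finSumFinEquiv.symm

lemma trace_finDirectSum {d e : ℕ} (X : Matrix (Fin d) (Fin d) ℝ)
    (Y : Matrix (Fin e) (Fin e) ℝ) : (finDirectSum X Y).trace = X.trace + Y.trace := by
  simp [finDirectSum, Matrix.trace, Fin.sum_univ_add]

lemma finDirectSum_mul {d e : ℕ} (X X' : Matrix (Fin d) (Fin d) ℝ)
    (Y Y' : Matrix (Fin e) (Fin e) ℝ) :
    finDirectSum X Y * finDirectSum X' Y' = finDirectSum (X * X') (Y * Y') := by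
  simp [finDirectSum, submatrix_mul_equiv, fromBlocks_multiply]

lemma Matrix.PosSemidef.exists_eq_transpose_mul_self {d : ℕ} {X : Matrix (Fin d) (Fin d) ℝ}
    (hX : X.PosSemidef) : ∃ B : Matrix (Fin d) (Fin d) ℝ, X = Bᵀ * B := by
  open scoped MatrixOrder Matrix.Norms.L2Operator in
  obtain ⟨B, hB⟩ := CStarAlgebra.nonneg_iff_eq_star_mul_self.mp hX.nonneg
  exact ⟨B, by rw [hB, star_eq_conjTranspose, conjTranspose_eq_transpose_of_trivial]⟩

lemma posSemidef_transpose_mul_self {d : ℕ} (B : Matrix (Fin d) (Fin d) ℝ) :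
    (Bᵀ * B).PosSemidef := by
  rw [← conjTranspose_eq_transpose_of_trivial]
  exact posSemidef_conjTranspose_mul_self B

lemma Matrix.PosSemidef.finDirectSum {d e : ℕ} {X : Matrix (Fin d) (Fin d) ℝ}
    {Y : Matrix (Fin e) (Fin e) ℝ} (hX : X.PosSemidef) (hY : Y.PosSemidef) :
    (finDirectSum X Y).PosSemidef := by
  obtain ⟨B, rfl⟩ := hX.exists_eq_transpose_mul_self
  obtain ⟨C, rfl⟩ := hY.exists_eq_transpose_mul_self
  have h : _root_.finDirectSum (Bᵀ * B) (Cᵀ * C)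
      = (_root_.finDirectSum B C)ᵀ * _root_.finDirectSum B C := by
    rw [← finDirectSum_mul]
    simp [_root_.finDirectSum, fromBlocks_transpose]
  rw [h]
  exact posSemidef_transpose_mul_self _

lemma gramMat_finDirectSum {n d e : ℕ} (X : Fin n → Matrix (Fin d) (Fin d) ℝ)
    (Y : Fin n → Matrix (Fin e) (Fin e) ℝ) :
    gramMat (fun i => finDirectSum (X i) (Y i)) = gramMat X + gramMat Y := by
  ext i j
  simp [gramMat, finDirectSum_mul, trace_finDirectSum]

lemma gramMat_smul {n d : ℕ} (t : ℝ) (X : Fin n → Matrix (Fin d) (Fin d) ℝ) :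
    gramMat (fun i => t • X i) = t ^ 2 • gramMat X := by
  ext i j
  simp [gramMat, pow_two, mul_assoc]

lemma gramMat_zero (n d : ℕ) : gramMat (fun _ : Fin n => (0 : Matrix (Fin d) (Fin d) ℝ)) = 0 := by
  ext i j
  simp [gramMat]

lemma isSymm_gramMat {n d : ℕ} (X : Fin n → Matrix (Fin d) (Fin d) ℝ) : (gramMat X).IsSymm :=
  IsSymm.ext fun i j => trace_mul_comm (X j) (X i)

/-! ### The completely positive semidefinite cone is a convex cone -/

lemma isCSPlus_gramMat {n d : ℕ} (hd : 1 ≤ d) {X : Fin n → Matrix (Fin d) (Fin d) ℝ}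
    (hX : ∀ i, (X i).PosSemidef) : IsCSPlus (gramMat X) :=
  ⟨d, hd, X, hX, fun _ _ => rfl⟩

lemma IsCSPlus.exists_eq_gramMat {n : ℕ} {A : Matrix (Fin n) (Fin n) ℝ} (hA : IsCSPlus A) :
    ∃ d : ℕ, 1 ≤ d ∧ ∃ X : Fin n → Matrix (Fin d) (Fin d) ℝ,
      (∀ i, (X i).PosSemidef) ∧ A = gramMat X := by
  obtain ⟨d, hd, X, hX, h⟩ := hA
  exact ⟨d, hd, X, hX, Matrix.ext h⟩

lemma IsCSPlus.zero (n : ℕ) : IsCSPlus (0 : Matrix (Fin n) (Fin n) ℝ) := by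
  rw [← gramMat_zero n 1]
  exact isCSPlus_gramMat le_rfl fun _ => PosSemidef.zero

lemma IsCSPlus.add {n : ℕ} {A B : Matrix (Fin n) (Fin n) ℝ} (hA : IsCSPlus A)
    (hB : IsCSPlus B) : IsCSPlus (A + B) := by
  obtain ⟨d, hd, X, hX, rfl⟩ := hA.exists_eq_gramMat
  obtain ⟨e, -, Y, hY, rfl⟩ := hB.exists_eq_gramMat
  rw [← gramMat_finDirectSum]
  exact isCSPlus_gramMat (by lia) fun i => (hX i).finDirectSum (hY i)

lemma IsCSPlus.smul {n : ℕ} {A : Matrix (Fin n) (Fin n) ℝ} (hA : IsCSPlus A) {c : ℝ}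
    (hc : 0 ≤ c) : IsCSPlus (c • A) := by
  obtain ⟨d, hd, X, hX, rfl⟩ := hA.exists_eq_gramMat
  rw [← Real.sq_sqrt hc, ← gramMat_smul]
  exact isCSPlus_gramMat hd fun i => (hX i).smul (Real.sqrt_nonneg c)

lemma IsCSPlus.sum {n m : ℕ} {A : Fin m → Matrix (Fin n) (Fin n) ℝ}
    (hA : ∀ k, IsCSPlus (A k)) : IsCSPlus (∑ k, A k) :=
  Finset.sum_induction _ IsCSPlus (fun _ _ => IsCSPlus.add) (IsCSPlus.zero n) fun k _ => hA k

lemma InC.isCSPlus {n r : ℕ} (hr : 1 ≤ r) {A : Matrix (Fin n) (Fin n) ℝ} (hA : InC n r A) :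
    IsCSPlus A := by
  obtain ⟨m, c, X, hc, hX, rfl⟩ := hA
  exact IsCSPlus.sum fun k => (isCSPlus_gramMat hr (hX k).1).smul (hc k)

/-! ### The union of the cones `C_r^n` is a convex cone -/

lemma InC.zero (n r : ℕ) : InC n r 0 :=
  ⟨0, Fin.elim0, Fin.elim0, fun k => k.elim0, fun k => k.elim0, by simp⟩

lemma InC.add {n r : ℕ} {A B : Matrix (Fin n) (Fin n) ℝ} (hA : InC n r A) (hB : InC n r B) :
    InC n r (A + B) := by
  obtain ⟨m, c, X, hc, hX, rfl⟩ := hA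
  obtain ⟨m', c', X', hc', hX', rfl⟩ := hB
  refine ⟨m + m', Fin.append c c', Fin.append X X', fun k => ?_, fun k => ?_, ?_⟩
  · induction k using Fin.addCases <;> simp [hc, hc']
  · induction k using Fin.addCases <;> simp [hX, hX']
  · simp [Fin.sum_univ_add]

lemma InC.smul {n r : ℕ} {A : Matrix (Fin n) (Fin n) ℝ} (hA : InC n r A) {t : ℝ}
    (ht : 0 ≤ t) : InC n r (t • A) := by
  obtain ⟨m, c, X, hc, hX, rfl⟩ := hA
  exact ⟨m, fun k => t * c k, X, fun k => mul_nonneg ht (hc k), hX,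
    by simp [Finset.smul_sum, smul_smul]⟩

lemma RatDen.mono {r s : ℕ} (h : r ≤ s) {x : ℝ} (hx : RatDen r x) : RatDen s x := by
  obtain ⟨p, q, hq, hqr, rfl⟩ := hx
  exact ⟨p, q, hq, hqr.trans h, rfl⟩

lemma ratDen_zero {r : ℕ} (hr : 1 ≤ r) : RatDen r 0 :=
  ⟨0, 1, le_rfl, hr, by simp⟩

lemma ratDen_ratCast {r : ℕ} {x : ℚ} (hx : x.den ≤ r) : RatDen r (x : ℝ) :=
  ⟨x.num, x.den, x.den_pos, hx, by exact_mod_cast (Rat.num_div_den x).symm⟩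

/-- Padding a tuple of `d × d` matrices by zeros to size `d + e`. -/
lemma inUDelta_finDirectSum_zero {n d e : ℕ} (h : 1 ≤ d + e)
    {X : Fin n → Matrix (Fin d) (Fin d) ℝ} (hX : ∀ i, (X i).PosSemidef)
    (hT : ∑ i, (X i).trace = 1) (hD : ∀ i k l, RatDen (d + e) (X i k l)) :
    InUDelta n (d + e) fun i => finDirectSum (X i) (0 : Matrix (Fin e) (Fin e) ℝ) := by
  refine ⟨fun i => (hX i).finDirectSum PosSemidef.zero, by simpa [trace_finDirectSum] using hT,
    fun i k l => ?_⟩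
  induction k using Fin.addCases <;> induction l using Fin.addCases <;>
    simp [finDirectSum, hD, ratDen_zero h]

lemma InC.mono {n r s : ℕ} (hr : 1 ≤ r) (h : r ≤ s) {A : Matrix (Fin n) (Fin n) ℝ}
    (hA : InC n r A) : InC n s A := by
  obtain ⟨e, rfl⟩ := Nat.exists_eq_add_of_le h
  obtain ⟨m, c, X, hc, hX, rfl⟩ := hA
  refine ⟨m, c, fun k i => finDirectSum (X k i) 0, hc, fun k => ?_, ?_⟩
  · exact inUDelta_finDirectSum_zero (by lia) (hX k).1 (hX k).2.1
      fun i a b => ((hX k).2.2 i a b).mono h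
  · simp [gramMat_finDirectSum, gramMat_zero]

/-- The space of real symmetric matrices as a linear subspace. -/
def symSubmodule (n : ℕ) : Submodule ℝ (Matrix (Fin n) (Fin n) ℝ) where
  carrier := {A | A.IsSymm}
  add_mem' hA hB := IsSymm.add hA hB
  zero_mem' := isSymm_zero
  smul_mem' c _ hA := IsSymm.smul hA c

/-- The union of the cones `C_r^n` inside the space of symmetric matrices. -/
def symUnionC (n : ℕ) : Set (symSubmodule n) :=
  {A | ∃ r, 1 ≤ r ∧ InC n r A.val}

lemma convex_symUnionC (n : ℕ) : Convex ℝ (symUnionC n) := by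
  rintro A ⟨r, hr, hA⟩ B ⟨s, hs, hB⟩ a b ha hb -
  exact ⟨max r s, le_max_of_le_left hr,
    ((hA.mono hr (le_max_left r s)).smul ha).add ((hB.mono hs (le_max_right r s)).smul hb)⟩

/-! ### Density of the union of the cones -/

/-- The Gram matrix of a tuple of positive semidefinite matrices with rational entries lies in
some cone `C_r^n`. -/
lemma exists_inC_gramMat_of_rat {n d : ℕ} (hd : 1 ≤ d)
    (Y : Fin n → Matrix (Fin d) (Fin d) ℚ)
    (hY : ∀ i, ((Y i).map ((↑) : ℚ → ℝ)).PosSemidef) :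
    ∃ r, 1 ≤ r ∧ InC n r (gramMat fun i => (Y i).map ((↑) : ℚ → ℝ)) := by
  set Z : Fin n → Matrix (Fin d) (Fin d) ℝ := fun i => (Y i).map ((↑) : ℚ → ℝ) with hZ
  set t : ℚ := ∑ i, (Y i).trace with ht
  have htZ : (t : ℝ) = ∑ i, (Z i).trace := by simp [ht, hZ, Matrix.trace]
  have ht0 : 0 ≤ (t : ℝ) := htZ ▸ Finset.sum_nonneg fun i _ => (hY i).trace_nonneg
  rcases ht0.eq_or_lt with h0 | hpos
  · have hZ0 : Z = fun _ => 0 := by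
      rw [htZ, eq_comm, Finset.sum_eq_zero_iff_of_nonneg fun i _ => (hY i).trace_nonneg] at h0
      funext i
      exact (hY i).trace_eq_zero_iff.mp (h0 i (Finset.mem_univ i))
    exact ⟨1, le_rfl, by rw [hZ0, gramMat_zero]; exact InC.zero n 1⟩
  · let q : Fin n × Fin d × Fin d → ℚ := fun p => t⁻¹ * Y p.1 p.2.1 p.2.2
    let e : ℕ := ∑ p, (q p).den
    have hcone : InUDelta n (d + e) fun i => finDirectSum ((t : ℝ)⁻¹ • Z i) 0 := by
      refine inUDelta_finDirectSum_zero (by lia) (fun i => (hY i).smul (inv_nonneg.mpr ht0)) ?_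
        fun i k l => ?_
      · simp only [trace_smul, smul_eq_mul]
        rw [← Finset.mul_sum, ← htZ]
        exact inv_mul_cancel₀ hpos.ne'
      · have hle : (q (i, k, l)).den ≤ e :=
          Finset.single_le_sum (f := fun p => (q p).den) (fun _ _ => Nat.zero_le _)
            (Finset.mem_univ _)
        simpa [q, hZ] using ratDen_ratCast (hle.trans (Nat.le_add_left e d))
    refine ⟨d + e, by lia, 1, fun _ => (t : ℝ) ^ 2, fun _ => _, fun _ => sq_nonneg _,
      fun _ => hcone, ?_⟩
    simp [gramMat_finDirectSum, gramMat_zero, gramMat_smul, hpos.ne']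

lemma denseRange_matrixTuple_ratCast (n d : ℕ) :
    DenseRange fun (Q : Fin n → Matrix (Fin d) (Fin d) ℚ) (i : Fin n) =>
      (Q i).map ((↑) : ℚ → ℝ) :=
  DenseRange.piMap fun _ => DenseRange.piMap fun _ => DenseRange.piMap fun _ =>
    Rat.denseRange_cast (𝕜 := ℝ)

lemma IsCSPlus.mem_closure_symUnionC {n : ℕ} {A : symSubmodule n}
    (hA : IsCSPlus A.val) : A ∈ closure (symUnionC n) := by
  obtain ⟨d, hd, X, hX, hAX⟩ := hA.exists_eq_gramMat
  choose B hB using fun i => (hX i).exists_eq_transpose_mul_self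
  let f : (Fin n → Matrix (Fin d) (Fin d) ℝ) → symSubmodule n :=
    fun C => ⟨gramMat fun i => (C i)ᵀ * C i, isSymm_gramMat _⟩
  have hf : Continuous f := by
    refine Continuous.subtype_mk (continuous_matrix fun i j => ?_) _
    simp only [gramMat, of_apply]
    fun_prop
  have hAf : A = f B := Subtype.ext <| by
    simp only [hAX, f]
    congr 1
    exact funext hB
  rw [hAf]
  refine map_mem_closure hf (denseRange_matrixTuple_ratCast n d B) ?_
  rintro _ ⟨Q, rfl⟩
  have hQ : ∀ i, ((Q i)ᵀ * Q i).map ((↑) : ℚ → ℝ)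
      = ((Q i).map ((↑) : ℚ → ℝ))ᵀ * (Q i).map ((↑) : ℚ → ℝ) := fun i => by
    ext a b
    simp [mul_apply]
  have h := exists_inC_gramMat_of_rat hd (fun i => (Q i)ᵀ * Q i) fun i => by
    rw [hQ]
    exact posSemidef_transpose_mul_self _
  simpa only [symUnionC, Set.mem_ofPred_eq, f, hQ] using h

/-- A convex subset of a finite-dimensional space contains the interior of every set in which
it is dense. -/
lemma Convex.interior_subset_of_subset_closure {E : Type*} [NormedAddCommGroup E]
    [NormedSpace ℝ E] [FiniteDimensional ℝ E] {C D : Set E} (hC : Convex ℝ C)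
    (hD : D ⊆ closure C) : interior D ⊆ C := by
  intro x hx
  have hspan : affineSpan ℝ C = ⊤ := by
    rw [← top_le_iff, ← isOpen_interior.affineSpan_eq_top ⟨x, hx⟩, affineSpan_le]
    exact interior_subset.trans <| hD.trans <|
      closure_minimal (subset_affineSpan ℝ C) (affineSpan ℝ C).closed_of_finiteDimensional
  have hne := hC.interior_nonempty_iff_affineSpan_eq_top.mpr hspan
  exact interior_subset <|
    hC.interior_closure_eq_interior_of_nonempty_interior hne ▸ interior_mono hD hx

/-- The interior of `CS+^n`, taken within the space `S^n` of real symmetric matrices, is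
covered by the cones `C_r^n`, whose union is contained in `CS+^n`. -/
theorem stmt8 (n : ℕ) (hn : 1 ≤ n) :
    interior {A : {A : Matrix (Fin n) (Fin n) ℝ // A.IsSymm} | IsCSPlus A.val} ⊆
      {A : {A : Matrix (Fin n) (Fin n) ℝ // A.IsSymm} | ∃ r, 1 ≤ r ∧ InC n r A.val} ∧
    {A : {A : Matrix (Fin n) (Fin n) ℝ // A.IsSymm} | ∃ r, 1 ≤ r ∧ InC n r A.val} ⊆
      {A : {A : Matrix (Fin n) (Fin n) ℝ // A.IsSymm} | IsCSPlus A.val} := by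
  refine ⟨?_, fun A ⟨r, hr, hA⟩ => hA.isCSPlus hr⟩
  let _ : NormedAddCommGroup (Matrix (Fin n) (Fin n) ℝ) := Matrix.normedAddCommGroup
  let _ : NormedSpace ℝ (Matrix (Fin n) (Fin n) ℝ) := Matrix.normedSpace
  exact Convex.interior_subset_of_subset_closure (E := symSubmodule n) (convex_symUnionC n)
    fun A hA => IsCSPlus.mem_closure_symUnionC hA
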